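/- arXiv:1011.0688 — 9 statements merged into one kernel-verified Lean document; each statement's English description precedes it below -/
import Mathlib

section
/- For every well-formed timed game structure G and every parity index function Omega on its states, Win1(TimeDivBl1(Parity(Omega))) = WinTimeDiv1(Parity(Omega)); that is, a state s admits a (possibly non-receptive) player-1 strategy pi1 with Outcomes(s,pi1,pi2) ⊆ (TimeDiv ∩ Parity(Omega)) ∪ (Blameless_1 \ TimeDiv) for every player-2 strategy pi2, if and only if s admits a receptive player-1 strategy pi1 with Outcomes(s,pi1,pi2) ⊆ Parity(Omega) for every receptive player-2 strategy pi2. -/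
namespace TPG

/-- Player-1 actions: the actions of `A1` together with the wait action `⊥₁`
(`bot`) and the relinquishing action `⊥✶` (`rel`). -/
inductive P1Act (A1 : Type) where
  | act (a : A1)
  | bot
  | rel

/-- Player-2 actions: the actions of `A2` together with the wait action `⊥₂`. -/
inductive P2Act (A2 : Type) where
  | act (a : A2)
  | bot

/-- A timed game structure: available-move assignments and transition
functions for both players.  A move is a pair of a (nonnegative) real delay
and an action. -/
structure TGS (S A1 A2 : Type) where
  Gamma1 : S → Set (ℝ × P1Act A1)
  Gamma2 : S → Set (ℝ × P2Act A2)
  delta1 : S → ℝ × P1Act A1 → S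
  delta2 : S → ℝ × P2Act A2 → S

/-- The axioms of a timed game structure: delays of available moves are
nonnegative, stutter moves are always available, and availability and
transitions are compatible with splitting off an initial time elapse. -/
def TGS.Legal {S A1 A2 : Type} (G : TGS S A1 A2) : Prop :=
  (∀ (s : S) (m : ℝ × P1Act A1), m ∈ G.Gamma1 s → 0 ≤ m.1) ∧
  (∀ (s : S) (m : ℝ × P2Act A2), m ∈ G.Gamma2 s → 0 ≤ m.1) ∧
  (∀ s : S, ((0 : ℝ), P1Act.bot) ∈ G.Gamma1 s) ∧
  (∀ s : S, ((0 : ℝ), P2Act.bot) ∈ G.Gamma2 s) ∧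
  (∀ (s : S) (Δ Δ' : ℝ) (a : P1Act A1), 0 ≤ Δ' → Δ' ≤ Δ →
    ((Δ, a) ∈ G.Gamma1 s ↔
      ((Δ', P1Act.bot) ∈ G.Gamma1 s ∧
        (Δ - Δ', a) ∈ G.Gamma1 (G.delta1 s (Δ', P1Act.bot))))) ∧
  (∀ (s : S) (Δ Δ' : ℝ) (a : P1Act A1), 0 ≤ Δ' → Δ' ≤ Δ → (Δ, a) ∈ G.Gamma1 s →
    G.delta1 s (Δ, a) = G.delta1 (G.delta1 s (Δ', P1Act.bot)) (Δ - Δ', a)) ∧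
  (∀ (s : S) (Δ Δ' : ℝ) (a : P2Act A2), 0 ≤ Δ' → Δ' ≤ Δ →
    ((Δ, a) ∈ G.Gamma2 s ↔
      ((Δ', P2Act.bot) ∈ G.Gamma2 s ∧
        (Δ - Δ', a) ∈ G.Gamma2 (G.delta2 s (Δ', P2Act.bot))))) ∧
  (∀ (s : S) (Δ Δ' : ℝ) (a : P2Act A2), 0 ≤ Δ' → Δ' ≤ Δ → (Δ, a) ∈ G.Gamma2 s →
    G.delta2 s (Δ, a) = G.delta2 (G.delta2 s (Δ', P2Act.bot)) (Δ - Δ', a))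

/-- Membership in the joint destination: the move of shorter duration wins
(both states are possible on equal durations); if player 1 relinquishes
(action `⊥✶`) the move of player 2 determines the successor. -/
def TGS.jdMem {S A1 A2 : Type} (G : TGS S A1 A2) (s : S)
    (m1 : ℝ × P1Act A1) (m2 : ℝ × P2Act A2) (s' : S) : Prop :=
  (m1.2 = P1Act.rel ∧ s' = G.delta2 s m2) ∨
  (m1.2 ≠ P1Act.rel ∧ m1.1 < m2.1 ∧ s' = G.delta1 s m1) ∨
  (m1.2 ≠ P1Act.rel ∧ m2.1 < m1.1 ∧ s' = G.delta2 s m2) ∨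
  (m1.2 ≠ P1Act.rel ∧ m1.1 = m2.1 ∧ (s' = G.delta1 s m1 ∨ s' = G.delta2 s m2))

/-- The time elapsed when the moves `m1` and `m2` are proposed. -/
def mdelay {A1 A2 : Type} (m1 : ℝ × P1Act A1) (m2 : ℝ × P2Act A2) : ℝ :=
  match m1.2 with
  | P1Act.rel => m2.1
  | _ => min m1.1 m2.1

/-- Player 1 is responsible for the state change from `s` to `s'`. -/
def TGS.Blame1 {S A1 A2 : Type} (G : TGS S A1 A2) (s : S)
    (m1 : ℝ × P1Act A1) (m2 : ℝ × P2Act A2) (s' : S) : Prop :=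
  m1.1 ≤ m2.1 ∧ G.delta1 s m1 = s' ∧ m1.2 ≠ P1Act.rel

/-- Player 2 is responsible for the state change from `s` to `s'`. -/
def TGS.Blame2 {S A1 A2 : Type} (G : TGS S A1 A2) (s : S)
    (m1 : ℝ × P1Act A1) (m2 : ℝ × P2Act A2) (s' : S) : Prop :=
  (m2.1 ≤ m1.1 ∧ G.delta2 s m2 = s') ∨ m1.2 = P1Act.rel

/-- A run of a timed game structure: an infinite sequence of states and
simultaneously proposed moves, each successor lying in the joint
destination. -/
structure TGS.Run {S A1 A2 : Type} (G : TGS S A1 A2) where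
  st : ℕ → S
  m1 : ℕ → ℝ × P1Act A1
  m2 : ℕ → ℝ × P2Act A2
  mem1 : ∀ k, m1 k ∈ G.Gamma1 (st k)
  mem2 : ∀ k, m2 k ∈ G.Gamma2 (st k)
  step : ∀ k, G.jdMem (st k) (m1 k) (m2 k) (st (k + 1))

/-- Time diverges along the run. -/
def TGS.Run.TimeDiv {S A1 A2 : Type} {G : TGS S A1 A2} (r : G.Run) : Prop :=
  Filter.Tendsto (fun n => ∑ k ∈ Finset.range n, mdelay (r.m1 k) (r.m2 k))
    Filter.atTop Filter.atTop

/-- Player 1 is responsible for only finitely many transitions of the run. -/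
def TGS.Run.Blameless1 {S A1 A2 : Type} {G : TGS S A1 A2} (r : G.Run) : Prop :=
  ∃ N, ∀ k, N ≤ k → ¬ G.Blame1 (r.st k) (r.m1 k) (r.m2 k) (r.st (k + 1))

/-- Player 2 is responsible for only finitely many transitions of the run. -/
def TGS.Run.Blameless2 {S A1 A2 : Type} {G : TGS S A1 A2} (r : G.Run) : Prop :=
  ∃ N, ∀ k, N ≤ k → ¬ G.Blame2 (r.st k) (r.m1 k) (r.m2 k) (r.st (k + 1))

/-- A finite run prefix: the past steps (state and both moves) together with
the current state. -/
def Hist (S A1 A2 : Type) : Type :=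
  List (S × (ℝ × P1Act A1) × (ℝ × P2Act A2)) × S

/-- A strategy of player 1 assigns a move to every run prefix. -/
def Strat1 (S A1 A2 : Type) : Type := Hist S A1 A2 → ℝ × P1Act A1

/-- A strategy of player 2 assigns a move to every run prefix. -/
def Strat2 (S A1 A2 : Type) : Type := Hist S A1 A2 → ℝ × P2Act A2

/-- The strategy always prescribes available moves. -/
def Strat1Valid {S A1 A2 : Type} (G : TGS S A1 A2) (σ : Strat1 S A1 A2) : Prop :=
  ∀ h : Hist S A1 A2, σ h ∈ G.Gamma1 h.2

/-- The strategy always prescribes available moves. -/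
def Strat2Valid {S A1 A2 : Type} (G : TGS S A1 A2) (σ : Strat2 S A1 A2) : Prop :=
  ∀ h : Hist S A1 A2, σ h ∈ G.Gamma2 h.2

/-- The prefix of the run `r` consisting of its first `k` steps. -/
def TGS.Run.hist {S A1 A2 : Type} {G : TGS S A1 A2} (r : G.Run) (k : ℕ) :
    Hist S A1 A2 :=
  ((List.range k).map (fun j => (r.st j, r.m1 j, r.m2 j)), r.st k)

/-- The runs from `s` in which both players follow their strategies. -/
def TGS.Outcomes {S A1 A2 : Type} (G : TGS S A1 A2) (s : S)
    (σ1 : Strat1 S A1 A2) (σ2 : Strat2 S A1 A2) : Set G.Run :=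
  {r | r.st 0 = s ∧ ∀ k, r.m1 k = σ1 (r.hist k) ∧ r.m2 k = σ2 (r.hist k)}

/-- A receptive strategy of player 1: no matter what the opponent does, it is
never responsible for blocking time. -/
def Receptive1 {S A1 A2 : Type} (G : TGS S A1 A2) (σ1 : Strat1 S A1 A2) : Prop :=
  ∀ σ2, Strat2Valid G σ2 → ∀ s : S, ∀ r ∈ G.Outcomes s σ1 σ2,
    r.TimeDiv ∨ r.Blameless1

/-- A receptive strategy of player 2. -/
def Receptive2 {S A1 A2 : Type} (G : TGS S A1 A2) (σ2 : Strat2 S A1 A2) : Prop :=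
  ∀ σ1, Strat1Valid G σ1 → ∀ s : S, ∀ r ∈ G.Outcomes s σ1 σ2,
    r.TimeDiv ∨ r.Blameless2

/-- A timed game structure is well-formed if both players have receptive
strategies. -/
def WellFormed {S A1 A2 : Type} (G : TGS S A1 A2) : Prop :=
  (∃ σ1, Strat1Valid G σ1 ∧ Receptive1 G σ1) ∧
  (∃ σ2, Strat2Valid G σ2 ∧ Receptive2 G σ2)

/-- `P` holds at infinitely many indices. -/
def InfOft (P : ℕ → Prop) : Prop := ∀ N, ∃ k, N ≤ k ∧ P k

/-- The maximal value taken infinitely often by `f` is even. -/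
def MaxInfOftEven (f : ℕ → ℕ) : Prop :=
  ∃ i, Even i ∧ InfOft (fun k => f k = i) ∧ ∀ j, InfOft (fun k => f k = j) → j ≤ i

/-- The parity objective for the index function `Ω`: the maximal index visited
infinitely often is even. -/
def ParityRun {S A1 A2 : Type} {G : TGS S A1 A2} (Ω : S → ℕ) (r : G.Run) : Prop :=
  MaxInfOftEven (fun k => Ω (r.st k))

/-- `Win1`: the states from which some player-1 strategy achieves `Φ` against
every player-2 strategy. -/
def TGS.Win1 {S A1 A2 : Type} (G : TGS S A1 A2) (Φ : Set G.Run) : Set S :=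
  {s | ∃ σ1, Strat1Valid G σ1 ∧
    ∀ σ2, Strat2Valid G σ2 → ∀ r ∈ G.Outcomes s σ1 σ2, r ∈ Φ}

/-- `WinTimeDiv1`: the states from which some receptive player-1 strategy
achieves `Φ` against every receptive player-2 strategy. -/
def TGS.WinTimeDiv1 {S A1 A2 : Type} (G : TGS S A1 A2) (Φ : Set G.Run) : Set S :=
  {s | ∃ σ1, Strat1Valid G σ1 ∧ Receptive1 G σ1 ∧
    ∀ σ2, Strat2Valid G σ2 → Receptive2 G σ2 → ∀ r ∈ G.Outcomes s σ1 σ2, r ∈ Φ}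

/-- `TimeDivBl1 Φ`: either time diverges and `Φ` holds, or time converges and
player 1 is blamed only finitely often. -/
def TimeDivBl1Set {S A1 A2 : Type} (G : TGS S A1 A2) (Φ : Set G.Run) : Set G.Run :=
  {r | (r.TimeDiv ∧ r ∈ Φ) ∨ (r.Blameless1 ∧ ¬ r.TimeDiv)}

section

open Filter

variable {S A1 A2 : Type} {G : TGS S A1 A2}

/-- The initial state of a history. -/
def Hist.first (h : Hist S A1 A2) : S :=
  match h.1 with
  | [] => h.2
  | x :: _ => x.1

/-- The history consisting of the first `k` steps of `h`. -/
def Hist.trunc (h : Hist S A1 A2) (k : ℕ) : Hist S A1 A2 :=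
  (h.1.take k, match h.1[k]? with
    | some x => x.1
    | none => h.2)

/-- The history obtained from `h` by forgetting its first `k` steps. -/
def Hist.drop (h : Hist S A1 A2) (k : ℕ) : Hist S A1 A2 :=
  (h.1.drop k, h.2)

namespace TGS.Run

lemma length_hist (r : G.Run) (k : ℕ) : (r.hist k).1.length = k := by
  simp [hist]

lemma first_hist (r : G.Run) (k : ℕ) : (r.hist k).first = r.st 0 := by
  cases k with
  | zero => rfl
  | succ k => simp [hist, Hist.first, List.range_succ_eq_map]

lemma trunc_hist (r : G.Run) {k n : ℕ} (hkn : k ≤ n) :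
    (r.hist n).trunc k = r.hist k := by
  refine Prod.ext ?_ ?_
  · simp [hist, Hist.trunc, ← List.map_take, List.take_range, hkn]
  · rcases hkn.lt_or_eq with h | rfl
    · simp [hist, Hist.trunc, h]
    · simp [hist, Hist.trunc]

/-- The suffix of a run starting at position `n`. -/
def shift (r : G.Run) (n : ℕ) : G.Run where
  st k := r.st (n + k)
  m1 k := r.m1 (n + k)
  m2 k := r.m2 (n + k)
  mem1 k := r.mem1 (n + k)
  mem2 k := r.mem2 (n + k)
  step k := r.step (n + k)

lemma drop_hist_add (r : G.Run) (n k : ℕ) :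
    (r.hist (n + k)).drop n = (r.shift n).hist k := by
  refine Prod.ext ?_ rfl
  simp [hist, Hist.drop, shift, List.range_add, Function.comp_def]

lemma TimeDiv.of_shift {r : G.Run} {n : ℕ} (h : (r.shift n).TimeDiv) : r.TimeDiv := by
  unfold TimeDiv at h ⊢
  rw [← tendsto_add_atTop_iff_nat n]
  refine (tendsto_atTop_add_const_left atTop
    (∑ k ∈ Finset.range n, mdelay (r.m1 k) (r.m2 k)) h).congr fun m => ?_
  rw [add_comm m n, Finset.sum_range_add]
  rfl

lemma Blameless2.of_shift {r : G.Run} {n : ℕ} (h : (r.shift n).Blameless2) :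
    r.Blameless2 := by
  obtain ⟨N, hN⟩ := h
  refine ⟨n + N, fun k hk => ?_⟩
  obtain ⟨j, rfl⟩ := Nat.exists_eq_add_of_le (show n ≤ k by omega)
  exact hN j (by omega)

lemma moves_eq_of_hist_eq {r r' : G.Run} (h : ∀ k, r'.hist k = r.hist k) (k : ℕ) :
    r'.m1 k = r.m1 k ∧ r'.m2 k = r.m2 k := by
  have := congrArg (fun x : Hist S A1 A2 => x.1[k]?) (h (k + 1))
  simp only [hist, List.getElem?_map, List.getElem?_range (Nat.lt_succ_self k),
    Option.map_some, Option.some.injEq, Prod.mk.injEq] at this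
  exact this.2

lemma blame1_or_blame2 (r : G.Run) (k : ℕ) :
    G.Blame1 (r.st k) (r.m1 k) (r.m2 k) (r.st (k + 1)) ∨
      G.Blame2 (r.st k) (r.m1 k) (r.m2 k) (r.st (k + 1)) := by
  rcases r.step k with ⟨h, -⟩ | ⟨h, hlt, hs⟩ | ⟨-, hlt, hs⟩ | ⟨h, heq, hs | hs⟩
  · exact Or.inr (Or.inr h)
  · exact Or.inl ⟨hlt.le, hs.symm, h⟩
  · exact Or.inr (Or.inl ⟨hlt.le, hs.symm⟩)
  · exact Or.inl ⟨heq.le, hs.symm, h⟩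
  · exact Or.inr (Or.inl ⟨heq.ge, hs.symm⟩)

lemma not_blameless (r : G.Run) (h1 : r.Blameless1) (h2 : r.Blameless2) : False := by
  obtain ⟨N1, h1⟩ := h1
  obtain ⟨N2, h2⟩ := h2
  rcases r.blame1_or_blame2 (max N1 N2) with h | h
  · exact h1 _ (le_max_left _ _) h
  · exact h2 _ (le_max_right _ _) h

open Classical in
/-- Along the histories of any given run, player 1 can reproduce its own moves. -/
lemma exists_strat1 (r : G.Run) {τ : Strat1 S A1 A2} (hτ : Strat1Valid G τ) :
    ∃ σ1, Strat1Valid G σ1 ∧ ∀ k, r.m1 k = σ1 (r.hist k) := by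
  refine ⟨fun h => if h = r.hist h.1.length then r.m1 h.1.length else τ h,
    fun h => ?_, fun k => ?_⟩
  · dsimp only
    split_ifs with hh
    · rw [show h.2 = r.st h.1.length from congrArg Prod.snd hh]
      exact r.mem1 _
    · exact hτ h
  · simp only [length_hist, if_true]

end TGS.Run

/-- A receptive strategy of player 2 controls every run in which player 2 follows it. -/
lemma Receptive2.timeDiv_or_blameless2 {σ2 : Strat2 S A1 A2} (h2 : Receptive2 G σ2)
    {τ : Strat1 S A1 A2} (hτ : Strat1Valid G τ) (r : G.Run)
    (hr : ∀ k, r.m2 k = σ2 (r.hist k)) : r.TimeDiv ∨ r.Blameless2 := by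
  obtain ⟨σ1, hv, hσ1⟩ := r.exists_strat1 hτ
  exact h2 σ1 hv _ r ⟨rfl, fun k => ⟨hσ1 k, hr k⟩⟩

lemma exists_trunc_ne_hist (r : G.Run) (h : Hist S A1 A2) :
    ∃ j, h.trunc j ≠ r.hist j := by
  refine ⟨h.1.length + 1, fun he => ?_⟩
  have := congrArg (fun x : Hist S A1 A2 => x.1.length) he
  simp [Hist.trunc, TGS.Run.length_hist] at this

open Classical in
/-- The first position at which the history `h` differs from the run `r`. -/
noncomputable def deviation (r : G.Run) (h : Hist S A1 A2) : ℕ :=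
  Nat.find (exists_trunc_ne_hist r h)

lemma deviation_spec (r : G.Run) (h : Hist S A1 A2) :
    h.trunc (deviation r h) ≠ r.hist (deviation r h) := by
  classical exact Nat.find_spec (exists_trunc_ne_hist r h)

lemma trunc_eq_of_lt_deviation {r : G.Run} {h : Hist S A1 A2} {j : ℕ}
    (hj : j < deviation r h) : h.trunc j = r.hist j := by
  classical exact not_not.1 (Nat.find_min (exists_trunc_ne_hist r h) hj)

lemma deviation_eq {r : G.Run} {h : Hist S A1 A2} {j : ℕ} (hj : h.trunc j ≠ r.hist j)
    (hlt : ∀ i < j, h.trunc i = r.hist i) : deviation r h = j := by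
  classical exact (Nat.find_eq_iff _).2 ⟨hj, fun i hi => not_not.2 (hlt i hi)⟩

/-- The player-2 strategy that follows the run `r` until the history deviates from it, and
plays `σ` on the remaining history afterwards. -/
noncomputable def followThen (r : G.Run) (σ : Strat2 S A1 A2) : Strat2 S A1 A2 := fun h =>
  if deviation r h ≤ h.1.length then σ (h.drop (deviation r h)) else r.m2 h.1.length

lemma followThen_valid (r : G.Run) {σ : Strat2 S A1 A2} (hσ : Strat2Valid G σ) :
    Strat2Valid G (followThen r σ) := by
  intro h
  unfold followThen
  split_ifs with hd
  · exact hσ (h.drop _)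
  · have := congrArg Prod.snd (trunc_eq_of_lt_deviation (not_le.1 hd))
    simp only [Hist.trunc, List.getElem?_length] at this
    rw [this]
    exact r.mem2 _

lemma followThen_hist (r : G.Run) (σ : Strat2 S A1 A2) (k : ℕ) :
    followThen r σ (r.hist k) = r.m2 k := by
  have hd : ¬ deviation r (r.hist k) ≤ k := fun hle =>
    deviation_spec r (r.hist k) (r.trunc_hist hle)
  rw [followThen, TGS.Run.length_hist, if_neg hd]

lemma followThen_receptive {r : G.Run} (hr : r.TimeDiv) {σ : Strat2 S A1 A2}
    (hσ : Receptive2 G σ) : Receptive2 G (followThen r σ) := by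
  classical
  intro σ1 hσ1 s q hq
  by_cases hdev : ∃ j, q.hist j ≠ r.hist j
  · set D := Nat.find hdev with hD
    have hdev_eq : ∀ k, deviation r (q.hist (D + k)) = D := fun k => by
      refine deviation_eq ?_ fun i hi => ?_
      · rw [q.trunc_hist (Nat.le_add_right D k)]
        exact Nat.find_spec hdev
      · rw [q.trunc_hist (by omega)]
        exact not_not.1 (Nat.find_min hdev hi)
    have hfollow : ∀ k, (q.shift D).m2 k = σ ((q.shift D).hist k) := fun k => by
      rw [← q.drop_hist_add]
      refine (hq.2 (D + k)).2.trans ?_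
      rw [followThen, hdev_eq, TGS.Run.length_hist, if_pos (Nat.le_add_right D k)]
    exact (hσ.timeDiv_or_blameless2 hσ1 _ hfollow).imp
      TGS.Run.TimeDiv.of_shift TGS.Run.Blameless2.of_shift
  · have hmv := TGS.Run.moves_eq_of_hist_eq (not_exists_not.1 hdev)
    refine Or.inl (hr.congr fun n => ?_)
    exact Finset.sum_congr rfl fun k _ => by rw [(hmv k).1, (hmv k).2]

theorem winTimeDiv1_subset_win1 (hWF : WellFormed G) (Φ : Set G.Run) :
    G.WinTimeDiv1 Φ ⊆ G.Win1 (TimeDivBl1Set G Φ) := by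
  obtain ⟨-, ρ, hρ, hρr⟩ := hWF
  rintro s ⟨σ1, hv, hrec, hwin⟩
  refine ⟨σ1, hv, fun σ2 hσ2 r hr => ?_⟩
  by_cases hdiv : r.TimeDiv
  · refine Or.inl ⟨hdiv, hwin (followThen r ρ) (followThen_valid r hρ)
      (followThen_receptive hdiv hρr) r ⟨hr.1, fun k => ⟨(hr.2 k).1, ?_⟩⟩⟩
    exact (followThen_hist r ρ k).symm
  · exact Or.inr ⟨(hrec σ2 hσ2 s r hr).resolve_left hdiv, hdiv⟩

theorem win1_subset_winTimeDiv1 (hWF : WellFormed G) (Φ : Set G.Run) :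
    G.Win1 (TimeDivBl1Set G Φ) ⊆ G.WinTimeDiv1 Φ := by
  classical
  obtain ⟨⟨ρ, hρ, hρr⟩, -⟩ := hWF
  rintro s ⟨σ1, hv, hwin⟩
  set τ : Strat1 S A1 A2 := fun h => if h.first = s then σ1 h else ρ h with hτ
  have hout : ∀ σ2 : Strat2 S A1 A2, ∀ r ∈ G.Outcomes s τ σ2, r ∈ G.Outcomes s σ1 σ2 :=
    fun σ2 r hr => ⟨hr.1, fun k => ⟨by
      rw [(hr.2 k).1, hτ]
      simp only [r.first_hist, hr.1, if_true], (hr.2 k).2⟩⟩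
  refine ⟨τ, fun h => ?_, fun σ2 hσ2 t r hr => ?_, fun σ2 hσ2 hrec r hr => ?_⟩
  · simp only [hτ]
    split_ifs
    exacts [hv h, hρ h]
  · by_cases hts : t = s
    · subst hts
      exact (hwin σ2 hσ2 r (hout σ2 r hr)).imp And.left And.left
    · refine hρr σ2 hσ2 t r ⟨hr.1, fun k => ⟨?_, (hr.2 k).2⟩⟩
      rw [(hr.2 k).1, hτ]
      simp only [r.first_hist, hr.1, if_neg hts]
  · rcases hwin σ2 hσ2 r (hout σ2 r hr) with h | ⟨hbl, hnd⟩
    · exact h.2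
    · exact (r.not_blameless hbl
        ((hrec σ1 hv s r (hout σ2 r hr)).resolve_left hnd)).elim

end

/-- for every well-formed timed game structure and every parity
index function, `Win1(TimeDivBl1(Parity Ω)) = WinTimeDiv1(Parity Ω)`. -/
theorem win_timeDivBl_eq_winTimeDiv
    {S A1 A2 : Type} (G : TGS S A1 A2) (hLegal : G.Legal) (hWF : WellFormed G)
    (d : ℕ) (hd : 1 ≤ d) (Ω : S → ℕ) (hΩ : ∀ s, Ω s < d) :
    G.Win1 (TimeDivBl1Set G {r : G.Run | ParityRun Ω r}) =
      G.WinTimeDiv1 {r : G.Run | ParityRun Ω r} := by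
  exact (win1_subset_winTimeDiv1 hWF _).antisymm (winTimeDiv1_subset_win1 hWF _)

end TPG
end

section
/- Let G be a timed game structure, Phi a set of runs of G, and r = s0,(m1^0,m2^0),s1,(m1^1,m2^1),... a run of G. Define sequences z_k ∈ [0,1) and Booleans tick_k, bl_k by z_0 = 0, tick_0 = bl_0 = false, and z_{k+1} = frac(z_k + delay(m1^k,m2^k)), tick_{k+1} = (z_k + delay(m1^k,m2^k) ≥ 1), bl_{k+1} = Blame1(s_k, m1^k, m2^k, s_{k+1}). Then r ∈ TimeDivBl1(Phi) if and only if both of the following hold: if tick_k = true for infinitely many k then r ∈ Phi, and if tick_k = true for only finitely many k then bl_k = true for only finitely many k. -/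
namespace TPG

theorem mdelay_nonneg {A1 A2 : Type} {m1 : ℝ × P1Act A1} {m2 : ℝ × P2Act A2}
    (h1 : 0 ≤ m1.1) (h2 : 0 ≤ m2.1) : 0 ≤ mdelay m1 m2 := by
  unfold mdelay
  split
  · exact h2
  · exact le_min h1 h2

/-- The clock that wraps around at `1` shows the fractional part of the elapsed time. -/
theorem clock_eq_fract_sum {d z : ℕ → ℝ} (hz0 : z 0 = 0)
    (hz : ∀ k, z (k + 1) = Int.fract (z k + d k)) (n : ℕ) :
    z n = Int.fract (∑ k ∈ Finset.range n, d k) := by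
  induction n with
  | zero => simp [hz0]
  | succ n ih =>
    rw [hz, ih, Finset.sum_range_succ, Int.fract_eq_fract]
    refine ⟨-⌊∑ k ∈ Finset.range n, d k⌋, ?_⟩
    rw [Int.fract]
    push_cast
    ring

theorem one_le_fract_add_iff (a b : ℝ) : 1 ≤ Int.fract a + b ↔ ⌊a⌋ < ⌊a + b⌋ := by
  rw [← Int.add_one_le_iff, Int.le_floor, Int.fract]
  push_cast
  constructor <;> intro h <;> linarith

/-- A monotone real sequence tends to infinity iff its integer part increases infinitely often. -/
theorem tendsto_atTop_iff_infOft_floor_lt {T : ℕ → ℝ} (hT : Monotone T) :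
    Filter.Tendsto T Filter.atTop Filter.atTop ↔
      InfOft (fun k => ⌊T k⌋ < ⌊T (k + 1)⌋) := by
  constructor
  · intro h N
    by_contra! hN
    have hle : ∀ n, N ≤ n → ⌊T n⌋ ≤ ⌊T N⌋ := fun n hn => by
      induction n, hn using Nat.le_induction with
      | base => exact le_rfl
      | succ n hn ih => exact (hN n hn).trans ih
    obtain ⟨n, hn, hTn⟩ :=
      ((Filter.eventually_ge_atTop N).and (h.eventually_ge_atTop ((⌊T N⌋ + 1 : ℤ) : ℝ))).exists
    have := Int.le_floor.mpr hTn
    have := hle n hn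
    omega
  · intro h
    have hunb : ∀ m : ℕ, ∃ n, ⌊T 0⌋ + m ≤ ⌊T n⌋ := fun m => by
      induction m with
      | zero => exact ⟨0, by simp⟩
      | succ m ih =>
        obtain ⟨n, hn⟩ := ih
        obtain ⟨k, hk, hlt⟩ := h n
        have := Int.floor_mono (hT hk)
        exact ⟨k + 1, by push_cast; omega⟩
    refine Filter.tendsto_atTop_atTop_of_monotone hT fun b => ?_
    obtain ⟨n, hn⟩ := hunb (⌈b⌉ - ⌊T 0⌋).toNat
    exact ⟨n, (Int.le_ceil b).trans (Int.le_floor.mp (by omega))⟩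

theorem infOft_succ_iff {P : ℕ → Prop} : InfOft (fun k => P (k + 1)) ↔ InfOft P := by
  constructor
  · intro h N
    obtain ⟨k, hk, hP⟩ := h N
    exact ⟨k + 1, by omega, hP⟩
  · intro h N
    obtain ⟨k, hk, hP⟩ := h (N + 1)
    obtain ⟨j, rfl⟩ : ∃ j, k = j + 1 := ⟨k - 1, by omega⟩
    exact ⟨j, by omega, hP⟩

theorem TGS.Run.blameless1_iff {S A1 A2 : Type} {G : TGS S A1 A2} (r : G.Run) :
    r.Blameless1 ↔
      ¬ InfOft (fun k => G.Blame1 (r.st k) (r.m1 k) (r.m2 k) (r.st (k + 1))) := by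
  simp only [TGS.Run.Blameless1, InfOft, not_forall, not_exists, not_and]

/-- the objective `TimeDivBl1 Φ` on a run coincides with the
condition expressed through the auxiliary sequences `z` (global fractional
clock), `tick` (an integer time boundary was just crossed) and `bl` (player 1
was just blamed). -/
theorem timeDivBl_iff_tick_blame_encoding
    {S A1 A2 : Type} (G : TGS S A1 A2) (hLegal : G.Legal)
    (Φ : Set G.Run) (r : G.Run)
    (z : ℕ → ℝ) (tick bl : ℕ → Prop)
    (hz0 : z 0 = 0) (ht0 : ¬ tick 0) (hb0 : ¬ bl 0)
    (hz : ∀ k, z (k + 1) = Int.fract (z k + mdelay (r.m1 k) (r.m2 k)))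
    (ht : ∀ k, tick (k + 1) ↔ 1 ≤ z k + mdelay (r.m1 k) (r.m2 k))
    (hb : ∀ k, bl (k + 1) ↔ G.Blame1 (r.st k) (r.m1 k) (r.m2 k) (r.st (k + 1))) :
    r ∈ TimeDivBl1Set G Φ ↔
      ((InfOft tick → r ∈ Φ) ∧ (¬ InfOft tick → ¬ InfOft bl)) := by
  have hT : Monotone fun n => ∑ k ∈ Finset.range n, mdelay (r.m1 k) (r.m2 k) :=
    monotone_nat_of_le_succ fun n => by
      rw [Finset.sum_range_succ]
      exact le_add_of_nonneg_right
        (mdelay_nonneg (hLegal.1 _ _ (r.mem1 n)) (hLegal.2.1 _ _ (r.mem2 n)))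
  have htick : r.TimeDiv ↔ InfOft tick := by
    rw [TGS.Run.TimeDiv, tendsto_atTop_iff_infOft_floor_lt hT, ← infOft_succ_iff (P := tick)]
    simp only [ht, clock_eq_fract_sum hz0 hz, one_le_fract_add_iff, Finset.sum_range_succ]
  have hbl : r.Blameless1 ↔ ¬ InfOft bl := by
    rw [r.blameless1_iff, ← infOft_succ_iff (P := bl)]
    simp only [hb]
  rw [TimeDivBl1Set, Set.mem_ofPred_eq, htick, hbl]
  tauto

end TPG
end

section
/- Let d ≥ 1 be an integer, let tick, bl : ℕ → Bool be arbitrary sequences, and let omega : ℕ → ℕ satisfy omega_k ≤ d−1 for all k. Define p : ℕ → ℕ by p_0 = omega_0 and, for k ≥ 0, p_{k+1} = omega_{k+1} if tick_k = true and p_{k+1} = max(p_k, omega_{k+1}) if tick_k = false. Define Omega_td : ℕ → ℕ by Omega_td(k) = 0 if tick_k = false and bl_k = false; Omega_td(k) = 1 if tick_k = false and bl_k = true; and Omega_td(k) = p_k + 2 if tick_k = true. Then max{i : Omega_td(k) = i for infinitely many k} is even if and only if both of the following hold: (a) if tick_k = true for infinitely many k, then max{i : omega_k = i for infinitely many k}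 is even; (b) if tick_k = true for only finitely many k, then bl_k = true for only finitely many k. -/
namespace TPG

theorem exists_infOft_eq_and_eventually_le {f : ℕ → ℕ} {B : ℕ} (hf : ∀ k, f k ≤ B) :
    ∃ i, InfOft (fun k => f k = i) ∧ ∃ N, ∀ k, N ≤ k → f k ≤ i := by
  classical
  have hex : ∃ i, ∃ N, ∀ k, N ≤ k → f k ≤ i := ⟨B, 0, fun k _ => hf k⟩
  obtain ⟨N, hN⟩ := Nat.find_spec hex
  refine ⟨Nat.find hex, fun M => ?_, N, hN⟩
  by_contra! hne
  have hlt : ∀ k, max N M ≤ k → f k < Nat.find hex := fun k hk =>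
    lt_of_le_of_ne (hN k (by omega)) (hne k (by omega))
  have hpos := hlt _ le_rfl
  exact Nat.find_min hex (m := Nat.find hex - 1) (by omega)
    ⟨max N M, fun k hk => by have := hlt k hk; omega⟩

theorem maxInfOftEven_iff_even {f : ℕ → ℕ} {i N : ℕ} (hi : InfOft (fun k => f k = i))
    (hN : ∀ k, N ≤ k → f k ≤ i) : MaxInfOftEven f ↔ Even i := by
  have hmax : ∀ j, InfOft (fun k => f k = j) → j ≤ i := by
    intro j hj
    obtain ⟨k, hk, rfl⟩ := hj N
    exact hN k hk
  constructor
  · rintro ⟨j, hj, hinf, hle⟩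
    rwa [le_antisymm (hle i hi) (hmax j hinf)]
  · exact fun h => ⟨i, h, hi, hmax⟩

/-- A value reached by a running maximum persists until the next reset. -/
theorem exists_tick_ge {tick : ℕ → Bool} {omega p : ℕ → ℕ}
    (hp : ∀ k, p (k + 1) = if tick k then omega (k + 1) else max (p k) (omega (k + 1)))
    (htick : InfOft (fun k => tick k = true)) (k : ℕ) :
    ∃ l, k ≤ l ∧ tick l = true ∧ p k ≤ p l := by
  obtain ⟨t, hkt, ht⟩ := htick k
  obtain ⟨n, rfl⟩ := Nat.exists_eq_add_of_le hkt
  clear hkt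
  induction n generalizing k with
  | zero => exact ⟨k, le_rfl, ht, le_rfl⟩
  | succ n ih =>
    by_cases hk : tick k = true
    · exact ⟨k, le_rfl, hk, le_rfl⟩
    · obtain ⟨l, hl, hlt, hle⟩ := ih (k + 1) (by rwa [Nat.add_right_comm])
      rw [hp, if_neg hk] at hle
      exact ⟨l, by omega, hlt, (le_max_left _ _).trans hle⟩

/-- correctness of the parity encoding `Ω_td` of the
time-divergence/blame adjusted parity objective. -/
theorem parity_encoding_of_time_divergence
    (d : ℕ) (hd : 1 ≤ d) (tick bl : ℕ → Bool) (omega : ℕ → ℕ)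
    (homega : ∀ k, omega k ≤ d - 1)
    (p : ℕ → ℕ) (hp0 : p 0 = omega 0)
    (hp : ∀ k, p (k + 1) = if tick k then omega (k + 1) else max (p k) (omega (k + 1)))
    (Ωtd : ℕ → ℕ)
    (hΩ : ∀ k, Ωtd k = if tick k then p k + 2 else (if bl k then 1 else 0)) :
    MaxInfOftEven Ωtd ↔
      ((InfOft (fun k => tick k = true) → MaxInfOftEven omega) ∧
        (¬ InfOft (fun k => tick k = true) → ¬ InfOft (fun k => bl k = true))) := by
  by_cases htick : InfOft (fun k => tick k = true)
  · obtain ⟨m, hm, N, hN⟩ := exists_infOft_eq_and_eventually_le homega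
    have hle : ∀ k, omega k ≤ p k := by
      rintro (_ | k)
      · exact hp0.ge
      · rw [hp]
        split_ifs
        exacts [le_rfl, le_max_right _ _]
    obtain ⟨t, hNt, ht⟩ := htick N
    have hpm : ∀ k, t + 1 ≤ k → p k ≤ m := by
      intro k hk
      induction k, hk using Nat.le_induction with
      | base =>
        rw [hp, if_pos ht]
        exact hN _ (by omega)
      | succ k hk ih =>
        have := hN (k + 1) (by omega)
        rw [hp]
        split_ifs
        exacts [this, max_le ih this]
    have hΩle : ∀ k, t + 1 ≤ k → Ωtd k ≤ m + 2 := by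
      intro k hk
      have := hpm k hk
      rw [hΩ]
      split_ifs <;> omega
    have hΩinf : InfOft (fun k => Ωtd k = m + 2) := by
      intro M
      obtain ⟨k, hk, hkm⟩ := hm (max M (t + 1))
      obtain ⟨l, hkl, hl, hpl⟩ := exists_tick_ge hp htick k
      have h₁ := hle k
      have h₂ := hpm l (by omega)
      refine ⟨l, by omega, ?_⟩
      simp only [hΩ, hl, if_true]
      omega
    rw [maxInfOftEven_iff_even hΩinf hΩle, maxInfOftEven_iff_even hm hN]
    simp [htick, Nat.even_add]
  · have hfin := htick
    simp only [InfOft, not_forall, not_exists, not_and] at hfin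
    obtain ⟨N, hN⟩ := hfin
    have hΩN : ∀ k, N ≤ k → Ωtd k = if bl k then 1 else 0 := fun k hk => by
      rw [hΩ, if_neg (hN k hk)]
    by_cases hbl : InfOft (fun k => bl k = true)
    · have hΩinf : InfOft (fun k => Ωtd k = 1) := by
        intro M
        obtain ⟨k, hk, hb⟩ := hbl (max M N)
        exact ⟨k, by omega, by simp [hΩN k (by omega), hb]⟩
      have hΩle : ∀ k, N ≤ k → Ωtd k ≤ 1 := fun k hk => by
        rw [hΩN k hk]
        split_ifs <;> omega
      rw [maxInfOftEven_iff_even hΩinf hΩle]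
      simp [htick, hbl]
    · have hfin := hbl
      simp only [InfOft, not_forall, not_exists, not_and] at hfin
      obtain ⟨M, hM⟩ := hfin
      have hΩzero : ∀ k, max M N ≤ k → Ωtd k = 0 := fun k hk => by
        rw [hΩN k (by omega), if_neg (hM k (by omega))]
      have hΩinf : InfOft (fun k => Ωtd k = 0) := fun K =>
        ⟨max K (max M N), by omega, hΩzero _ (by omega)⟩
      rw [maxInfOftEven_iff_even hΩinf fun k hk => (hΩzero k hk).le]
      simp [htick, hbl]

end TPG
end

section
/- Let d ≥ 1 be an integer, let tick, bl : ℕ → Bool be arbitrary sequences, let omega : ℕ → ℕ satisfy omega_k ≤ d−1 for all k, and let rb : ℕ → Bool satisfy: for all k, if rb_{k+1} = true then rb_k = true. Define p : ℕ → ℕ by p_0 = omega_0 and, for k ≥ 0, p_{k+1} = omega_{k+1} if tick_k = true and p_{k+1} = max(p_k, omega_{k+1}) if tick_k = false. Define Omega_rtd : ℕ → ℕ by Omega_rtd(k) = 1 if rb_k = false, and otherwise Omega_rtd(k) = 0 if tick_k = false and bl_k = false, Omega_rtd(k) = 1 if tick_k = false and bl_k = true, and Omega_rtd(k) = p_k +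 2 if tick_k = true. Then max{i : Omega_rtd(k) = i for infinitely many k} is even if and only if all three of the following hold: rb_k = true for every k; if tick_k = true for infinitely many k then max{i : omega_k = i for infinitely many k} is even; and if tick_k = true for only finitely many k then bl_k = true for only finitely many k. -/
namespace TPG

/-- `m` is the limit superior of `f`: it is attained infinitely often and eventually bounds `f`. -/
def IsLimsup (f : ℕ → ℕ) (m : ℕ) : Prop :=
  InfOft (fun k => f k = m) ∧ ∃ N, ∀ k, N ≤ k → f k ≤ m

theorem IsLimsup.maxInfOftEven_iff {f : ℕ → ℕ} {m : ℕ} (h : IsLimsup f m) :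
    MaxInfOftEven f ↔ Even m := by
  obtain ⟨hm, N, hN⟩ := h
  have hle : ∀ j, InfOft (fun k => f k = j) → j ≤ m := by
    intro j hj
    obtain ⟨k, hk, rfl⟩ := hj N
    exact hN k hk
  constructor
  · rintro ⟨i, hi, hinf, hmax⟩
    rwa [le_antisymm (hmax m hm) (hle i hinf)]
  · exact fun he => ⟨m, he, hm, hle⟩

theorem exists_isLimsup_of_eventually_le {f : ℕ → ℕ} {b : ℕ}
    (h : ∃ N, ∀ k, N ≤ k → f k ≤ b) : ∃ m, IsLimsup f m := by
  induction b with
  | zero =>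
    obtain ⟨N, hN⟩ := h
    exact ⟨0, fun M => ⟨max M N, le_max_left _ _, Nat.le_zero.mp (hN _ (le_max_right _ _))⟩, N, hN⟩
  | succ b ih =>
    by_cases hinf : InfOft (fun k => f k = b + 1)
    · exact ⟨b + 1, hinf, h⟩
    · obtain ⟨N, hN⟩ := h
      simp only [InfOft, not_forall, not_exists, not_and] at hinf
      obtain ⟨M, hM⟩ := hinf
      refine ih ⟨max M N, fun k hk => ?_⟩
      have hne := hM k (by omega)
      have hle := hN k (by omega)
      omega

theorem not_infOft {P : ℕ → Prop} : ¬ InfOft P ↔ ∃ N, ∀ k, N ≤ k → ¬ P k := by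
  simp [InfOft]

section RunningMax

variable {tick : ℕ → Bool} {omega p : ℕ → ℕ}

theorem omega_le_runningMax (hp0 : p 0 = omega 0)
    (hp : ∀ k, p (k + 1) = if tick k then omega (k + 1) else max (p k) (omega (k + 1))) (k : ℕ) :
    omega k ≤ p k := by
  cases k with
  | zero => exact hp0.ge
  | succ k =>
    rw [hp]
    split_ifs
    · exact le_rfl
    · exact le_max_right _ _

theorem exists_tick_runningMax_ge
    (hp : ∀ k, p (k + 1) = if tick k then omega (k + 1) else max (p k) (omega (k + 1)))
    {v : ℕ} (n k : ℕ) (hv : v ≤ p k) (ht : tick (k + n) = true) :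
    ∃ t, k ≤ t ∧ tick t = true ∧ v ≤ p t := by
  induction n generalizing k with
  | zero => exact ⟨k, le_rfl, ht, hv⟩
  | succ n ih =>
    by_cases hk : tick k = true
    · exact ⟨k, le_rfl, hk, hv⟩
    · have hv' : v ≤ p (k + 1) := by
        rw [hp, if_neg hk]
        exact le_max_of_le_left hv
      obtain ⟨t, hkt, htt, hvt⟩ := ih (k + 1) hv' (by rwa [Nat.add_right_comm])
      exact ⟨t, by omega, htt, hvt⟩

theorem runningMax_le_of_tick
    (hp : ∀ k, p (k + 1) = if tick k then omega (k + 1) else max (p k) (omega (k + 1)))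
    {m T : ℕ} (hT : tick T = true) (hm : ∀ k, T ≤ k → omega k ≤ m) {k : ℕ} (hk : T + 1 ≤ k) :
    p k ≤ m := by
  induction k, hk using Nat.le_induction with
  | base =>
    rw [hp, if_pos hT]
    exact hm _ (Nat.le_succ T)
  | succ k hk ih =>
    have hω := hm (k + 1) (by omega)
    rw [hp]
    split_ifs
    · exact hω
    · exact max_le ih hω

end RunningMax

/-- correctness of the parity encoding `Ω_rtd` of the
time-divergence/blame adjusted parity objective together with the requirement
that the robustness flag `rb` stays true throughout. -/
theorem parity_encoding_of_robust_time_divergence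
    (d : ℕ) (hd : 1 ≤ d) (tick bl : ℕ → Bool) (omega : ℕ → ℕ)
    (homega : ∀ k, omega k ≤ d - 1)
    (rb : ℕ → Bool) (hrb : ∀ k, rb (k + 1) = true → rb k = true)
    (p : ℕ → ℕ) (hp0 : p 0 = omega 0)
    (hp : ∀ k, p (k + 1) = if tick k then omega (k + 1) else max (p k) (omega (k + 1)))
    (Ωrtd : ℕ → ℕ)
    (hΩ : ∀ k, Ωrtd k =
      if rb k then (if tick k then p k + 2 else (if bl k then 1 else 0)) else 1) :
    MaxInfOftEven Ωrtd ↔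
      ((∀ k, rb k = true) ∧
        (InfOft (fun k => tick k = true) → MaxInfOftEven omega) ∧
        (¬ InfOft (fun k => tick k = true) → ¬ InfOft (fun k => bl k = true))) := by
  by_cases hr : ∀ k, rb k = true
  · simp only [hr, if_true] at hΩ
    by_cases ht : InfOft (fun k => tick k = true)
    · obtain ⟨m, hm⟩ := exists_isLimsup_of_eventually_le (f := omega) ⟨0, fun k _ => homega k⟩
      have hΩm : IsLimsup Ωrtd (m + 2) := by
        obtain ⟨hinf, N, hN⟩ := hm
        obtain ⟨T, hNT, hT⟩ := ht N
        have hpm : ∀ k, T + 1 ≤ k → p k ≤ m := fun k hk =>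
          runningMax_le_of_tick hp hT (fun j hj => hN j (hNT.trans hj)) hk
        refine ⟨fun M => ?_, T + 1, fun k hk => ?_⟩
        · obtain ⟨k, hk, hωk⟩ := hinf (max M (T + 1))
          obtain ⟨t, hkt, htt⟩ := ht k
          obtain ⟨s, hks, hts, hms⟩ := exists_tick_runningMax_ge hp (t - k) k
            (omega_le_runningMax hp0 hp k) (by rwa [Nat.add_sub_cancel' hkt])
          have hs := hpm s (by omega)
          refine ⟨s, by omega, ?_⟩
          simp only [hΩ, hts, if_true]
          omega
        · have := hpm k hk
          rw [hΩ]
          split_ifs <;> omega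
      rw [hΩm.maxInfOftEven_iff, hm.maxInfOftEven_iff, Nat.even_add]
      simp [hr, ht]
    · obtain ⟨N, hN⟩ := not_infOft.mp ht
      by_cases hb : InfOft (fun k => bl k = true)
      · have hΩ1 : IsLimsup Ωrtd 1 := by
          refine ⟨fun M => ?_, N, fun k hk => ?_⟩
          · obtain ⟨k, hk, hbk⟩ := hb (max M N)
            exact ⟨k, by omega, by simp [hΩ, hN k (by omega), hbk]⟩
          · rw [hΩ, if_neg (hN k hk)]
            split_ifs <;> omega
        simp [hΩ1.maxInfOftEven_iff, ht, hb]
      · obtain ⟨N', hN'⟩ := not_infOft.mp hb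
        have hΩ0 : ∀ k, max N N' ≤ k → Ωrtd k = 0 := fun k hk => by
          rw [hΩ, if_neg (hN k (by omega)), if_neg (hN' k (by omega))]
        have hlim : IsLimsup Ωrtd 0 :=
          ⟨fun M => ⟨max M (max N N'), le_max_left _ _, hΩ0 _ (le_max_right _ _)⟩,
            max N N', fun k hk => (hΩ0 k hk).le⟩
        simp [hlim.maxInfOftEven_iff, hr, ht, hb]
  · obtain ⟨N, hN⟩ := not_forall.mp hr
    have hfalse : ∀ k, N ≤ k → ¬ rb k = true := fun k hk =>
      Nat.le_induction hN (fun j _ hj h => hj (hrb j h)) k hk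
    have hΩ1 : ∀ k, N ≤ k → Ωrtd k = 1 := fun k hk => by rw [hΩ, if_neg (hfalse k hk)]
    have hlim : IsLimsup Ωrtd 1 :=
      ⟨fun M => ⟨max M N, le_max_left _ _, hΩ1 _ (le_max_right _ _)⟩,
        N, fun k hk => (hΩ1 k hk).le⟩
    rw [hlim.maxInfOftEven_iff]
    exact ⟨fun h => absurd h (by decide), fun h => absurd h.1 hr⟩

end TPG
end

section
/- Let C be a finite nonempty set, let Delta : ℕ → ℝ satisfy Delta_k ≥ 0 for all k, let lambda : ℕ → Set C, and let kappa : ℕ → (C → ℝ) satisfy kappa_0(x) ≥ 0 for all x ∈ C and, for all k and x ∈ C, kappa_{k+1}(x) = 0 if x ∈ lambda_k and kappa_{k+1}(x) = kappa_k(x) + Delta_k otherwise. If there are infinitely many k for which there exist x ∈ C and a positive integer m with kappa_k(x) < m < kappa_k(x) + Delta_k, then Σ_k Delta_k = ∞. -/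
/-- Between two instants, a clock that resets or advances by `Δ` either was reset, and then shows
at most the elapsed time, or has advanced by exactly the elapsed time. -/
theorem clock_le_elapsed_or_eq_add_elapsed {Δ : ℕ → ℝ} (hΔ : ∀ k, 0 ≤ Δ k) {u : ℕ → ℝ}
    (hu : ∀ k, u (k + 1) = 0 ∨ u (k + 1) = u k + Δ k) {j k : ℕ} (hjk : j ≤ k) :
    u k ≤ ∑ i ∈ Finset.range k, Δ i - ∑ i ∈ Finset.range j, Δ i ∨
      u k = u j + (∑ i ∈ Finset.range k, Δ i - ∑ i ∈ Finset.range j, Δ i) := by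
  induction k, hjk using Nat.le_induction with
  | base => right; ring
  | succ k hjk ih =>
    have hmono := monotone_nat_of_le_succ (f := fun n => ∑ i ∈ Finset.range n, Δ i)
      (fun n => by simpa [Finset.sum_range_succ] using hΔ n) hjk
    have hk := hΔ k
    simp only [Finset.sum_range_succ] at hmono ⊢
    rcases hu k with h | h
    · left; linarith
    · rcases ih with ih | ih
      · left; linarith
      · right; linarith

/-- A monotone real sequence that can always be increased by one tends to infinity. -/
theorem Monotone.tendsto_atTop_of_forall_exists_add_one_le {S : ℕ → ℝ} (hS : Monotone S)
    (h : ∀ N, ∃ n, S N + 1 ≤ S n) : Filter.Tendsto S Filter.atTop Filter.atTop := by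
  have key : ∀ a : ℕ, ∃ n, S 0 + a ≤ S n := by
    intro a
    induction a with
    | zero => exact ⟨0, by simp⟩
    | succ a ih =>
      obtain ⟨n, hn⟩ := ih
      obtain ⟨p, hp⟩ := h n
      exact ⟨p, by push_cast; linarith⟩
  refine Filter.tendsto_atTop_atTop_of_monotone hS fun b => ?_
  obtain ⟨a, ha⟩ := exists_nat_ge (b - S 0)
  obtain ⟨n, hn⟩ := key a
  exact ⟨n, by linarith⟩

/-- if along a run of a timed automaton some clock strictly
crosses a positive integer boundary at infinitely many steps, then the total
elapsed time diverges. -/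
theorem clock_boundary_crossings_imply_time_divergence
    {C : Type} [Fintype C] [Nonempty C]
    (Δ : ℕ → ℝ) (hΔ : ∀ k, 0 ≤ Δ k)
    (lam : ℕ → Set C) (κ : ℕ → C → ℝ)
    (h0 : ∀ x, 0 ≤ κ 0 x)
    (hreset : ∀ k x, x ∈ lam k → κ (k + 1) x = 0)
    (hflow : ∀ k x, x ∉ lam k → κ (k + 1) x = κ k x + Δ k)
    (hcross : ∀ N, ∃ k, N ≤ k ∧ ∃ (x : C) (m : ℕ),
      0 < m ∧ κ k x < (m : ℝ) ∧ (m : ℝ) < κ k x + Δ k) :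
    Filter.Tendsto (fun n => ∑ k ∈ Finset.range n, Δ k) Filter.atTop Filter.atTop := by
  have hmono : Monotone fun n => ∑ k ∈ Finset.range n, Δ k :=
    monotone_nat_of_le_succ fun n => by simpa [Finset.sum_range_succ] using hΔ n
  obtain ⟨x, hx⟩ : ∃ x, ∃ᶠ k in Filter.atTop, ∃ m : ℕ,
      0 < m ∧ κ k x < (m : ℝ) ∧ (m : ℝ) < κ k x + Δ k := by
    by_contra hne
    have hne := fun x => Filter.not_frequently.1 (not_exists.1 hne x)
    obtain ⟨N, hN⟩ := Filter.eventually_atTop.1 (Filter.eventually_all.2 hne)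
    obtain ⟨k, hk, x, hm⟩ := hcross N
    exact hN k hk x hm
  rw [Filter.frequently_atTop] at hx
  refine hmono.tendsto_atTop_of_forall_exists_add_one_le fun N => ?_
  obtain ⟨j, hNj, p, -, hjp, hpj⟩ := hx N
  obtain ⟨k, hjk, q, hq, hkq, hqk⟩ := hx (j + 1)
  have hu : ∀ i, κ (i + 1) x = 0 ∨ κ (i + 1) x = κ i x + Δ i := fun i => by
    by_cases hi : x ∈ lam i
    · exact Or.inl (hreset i x hi)
    · exact Or.inr (hflow i x hi)
  have hNj' := hmono hNj
  have hjk' := hmono hjk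
  refine ⟨k + 1, ?_⟩
  simp only [Finset.sum_range_succ] at hNj' hjk' ⊢
  rcases clock_le_elapsed_or_eq_add_elapsed (u := fun i => κ i x) hΔ hu (Nat.le_of_succ_le hjk) with h | h
  · have hq' : (1 : ℝ) ≤ q := by exact_mod_cast hq
    linarith
  · have hpq : (p : ℝ) < q := by linarith
    have hpq' : (p : ℝ) + 1 ≤ q := by exact_mod_cast hpq
    linarith
end

section
/- If kappa1 and kappa2 are clock valuations with kappa1 ≅ kappa2, then for every real Delta1 ≥ 0 there exists a real Delta2 ≥ 0 such that kappa1 + Delta1 ≅ kappa2 + Delta2. -/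
namespace TPG

/-- A clock valuation assigns a nonnegative real to every clock. -/
def ClkNonneg {C : Type} (κ : C → ℝ) : Prop := ∀ x, 0 ≤ κ x

/-- Region equivalence of clock valuations with respect to the clock
ceilings `c`. -/
def RegEquiv {C : Type} (c : C → ℕ) (κ1 κ2 : C → ℝ) : Prop :=
  (∀ x, κ1 x ≤ (c x : ℝ) ↔ κ2 x ≤ (c x : ℝ)) ∧
  (∀ x, κ1 x ≤ (c x : ℝ) → ⌊κ1 x⌋ = ⌊κ2 x⌋) ∧
  (∀ x y, κ1 x ≤ (c x : ℝ) → κ1 y ≤ (c y : ℝ) →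
    (Int.fract (κ1 x) ≤ Int.fract (κ1 y) ↔ Int.fract (κ2 x) ≤ Int.fract (κ2 y))) ∧
  (∀ x, κ1 x ≤ (c x : ℝ) → (Int.fract (κ1 x) = 0 ↔ Int.fract (κ2 x) = 0))

/-- Advance every clock by the delay `Δ`. -/
def shiftVal {C : Type} (κ : C → ℝ) (Δ : ℝ) : C → ℝ := fun x => κ x + Δ

open Classical in
/-- Reset the clocks in `rs` to `0`. -/
noncomputable def resetClk {C : Type} (κ : C → ℝ) (rs : Set C) : C → ℝ :=
  fun x => if x ∈ rs then 0 else κ x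

/-- Clock constraints: `x ≤ d`, `d ≤ x`, negation and conjunction. -/
inductive ClockConstraint (C : Type) where
  | le (x : C) (d : ℕ)
  | ge (x : C) (d : ℕ)
  | neg (θ : ClockConstraint C)
  | conj (θ1 θ2 : ClockConstraint C)

/-- Satisfaction of a clock constraint by a clock valuation. -/
def CCSat {C : Type} (κ : C → ℝ) : ClockConstraint C → Prop
  | ClockConstraint.le x d => κ x ≤ (d : ℝ)
  | ClockConstraint.ge x d => (d : ℝ) ≤ κ x
  | ClockConstraint.neg θ => ¬ CCSat κ θ
  | ClockConstraint.conj θ1 θ2 => CCSat κ θ1 ∧ CCSat κ θ2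

/-- The clock region of the valuation `κ`. -/
def regOf {C : Type} (c : C → ℕ) (κ : C → ℝ) : Set (C → ℝ) :=
  {κ' | ClkNonneg κ' ∧ RegEquiv c κ κ'}

/-- `Y` is a clock region (an equivalence class of region equivalence). -/
def IsRegion {C : Type} (c : C → ℕ) (Y : Set (C → ℝ)) : Prop :=
  ∃ κ, ClkNonneg κ ∧ Y = regOf c κ

/-- Without a wrap-around of the fractional part, a delay `n + (1 - s)` advances the floor by `n`. -/
lemma floor_fract_add_of_fract_lt {a s : ℝ} (n : ℤ) (hs : s ≤ 1) (h : Int.fract a < s) :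
    ⌊a + (n + (1 - s))⌋ = ⌊a⌋ + n ∧
      Int.fract (a + (n + (1 - s))) = Int.fract a + (1 - s) := by
  have hfloor : ⌊a + (n + (1 - s))⌋ = ⌊a⌋ + n := by
    rw [Int.floor_eq_iff]
    push_cast
    constructor <;> linarith [Int.floor_add_fract a, Int.fract_nonneg a]
  refine ⟨hfloor, ?_⟩
  rw [Int.fract, hfloor, Int.fract]
  push_cast
  ring

/-- With a wrap-around of the fractional part, a delay `n + (1 - s)` advances the floor by
`n + 1`. -/
lemma floor_fract_add_of_le_fract {a s : ℝ} (n : ℤ) (hs : 0 < s) (h : s ≤ Int.fract a) :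
    ⌊a + (n + (1 - s))⌋ = ⌊a⌋ + n + 1 ∧
      Int.fract (a + (n + (1 - s))) = Int.fract a - s := by
  have hfloor : ⌊a + (n + (1 - s))⌋ = ⌊a⌋ + n + 1 := by
    rw [Int.floor_eq_iff]
    push_cast
    constructor <;> linarith [Int.floor_add_fract a, Int.fract_lt_one a]
  refine ⟨hfloor, ?_⟩
  rw [Int.fract, hfloor, Int.fract]
  push_cast
  ring

lemma le_natCast_iff_floor_fract (a : ℝ) (m : ℕ) :
    a ≤ m ↔ ⌊a⌋ < (m : ℤ) ∨ ⌊a⌋ = (m : ℤ) ∧ Int.fract a = 0 := by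
  have ha := Int.floor_add_fract a
  constructor
  · intro h
    have hle : ⌊a⌋ ≤ (m : ℤ) := by
      have := Int.floor_mono h
      rwa [Int.floor_natCast] at this
    rcases hle.lt_or_eq with hlt | heq
    · exact Or.inl hlt
    · refine Or.inr ⟨heq, le_antisymm ?_ (Int.fract_nonneg a)⟩
      have : (⌊a⌋ : ℝ) = m := by exact_mod_cast heq
      linarith
  · rintro (h | ⟨h, h0⟩)
    · exact (Int.floor_lt.mp h).le
    · have : (⌊a⌋ : ℝ) = m := by exact_mod_cast h
      linarith

/-- A threshold `s` in `(0, 1]` among the values of `f` can be matched by a threshold among the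
values of an order-equivalent function `g`. -/
lemma exists_matching_threshold {ι : Type*} [Finite ι] (f g : ι → ℝ)
    (hg : ∀ i, 0 ≤ g i) (hf1 : ∀ i, f i < 1) (hg1 : ∀ i, g i < 1)
    (hle : ∀ i j, f i ≤ f j ↔ g i ≤ g j) (hzero : ∀ i, f i = 0 ↔ g i = 0)
    {s : ℝ} (hs0 : 0 < s) (hs1 : s ≤ 1) :
    ∃ t : ℝ, 0 < t ∧ t ≤ 1 ∧ (s = 1 ↔ t = 1) ∧
      (∀ i, f i < s ↔ g i < t) ∧ (∀ i, f i = s ↔ g i = t) := by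
  classical
  have := Fintype.ofFinite ι
  rcases hs1.eq_or_lt with rfl | hs1
  · exact ⟨1, one_pos, le_rfl, Iff.rfl, fun i => iff_of_true (hf1 i) (hg1 i),
      fun i => iff_of_false (hf1 i).ne (hg1 i).ne⟩
  by_cases hex : ∃ i, f i = s
  · obtain ⟨i, rfl⟩ := hex
    refine ⟨g i, (hg i).lt_of_ne fun h => hs0.ne' ((hzero i).2 h.symm), (hg1 i).le,
      iff_of_false hs1.ne (hg1 i).ne, fun j => ?_, fun j => ?_⟩
    · rw [← not_le, ← not_le, hle]
    · rw [le_antisymm_iff, le_antisymm_iff, hle, hle]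
  · push Not at hex
    obtain ⟨t, hlo, hhi⟩ := Order.exists_between_finsets
      (lo := insert 0 ((Finset.univ.filter fun i => f i < s).image g))
      (hi := insert 1 ((Finset.univ.filter fun i => s < f i).image g)) (by
        simp only [Finset.mem_insert, Finset.mem_image, Finset.mem_filter, Finset.mem_univ,
          true_and]
        rintro _ (rfl | ⟨i, hi, rfl⟩) _ (rfl | ⟨j, hj, rfl⟩)
        · exact one_pos
        · exact (hg j).lt_of_ne fun h => (hs0.trans hj).ne' ((hzero j).2 h.symm)
        · exact hg1 i
        · rw [← not_le, ← hle, not_le]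
          exact hi.trans hj)
    have hlow : ∀ i, f i < s → g i < t := fun i hi => hlo _ (by simp; exact Or.inr ⟨i, hi, rfl⟩)
    have hupp : ∀ i, s < f i → t < g i := fun i hi => hhi _ (by simp; exact Or.inr ⟨i, hi, rfl⟩)
    have ht1 : t < 1 := hhi 1 (by simp)
    refine ⟨t, hlo 0 (by simp), ht1.le, iff_of_false hs1.ne ht1.ne, fun i => ?_, fun i => ?_⟩
    · refine ⟨hlow i, fun h => ?_⟩
      by_contra hn
      exact (hupp i ((not_lt.1 hn).lt_of_ne (hex i).symm)).not_gt h
    · refine iff_of_false (hex i) ?_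
      rcases (hex i).lt_or_gt with h | h
      · exact (hlow i h).ne
      · exact (hupp i h).ne'

/-- time elapse preserves region equivalence (time-abstract
bisimulation, time-elapse part). -/
theorem regEquiv_time_elapse {C : Type} [Fintype C] (c : C → ℕ) (κ1 κ2 : C → ℝ)
    (h1 : ClkNonneg κ1) (h2 : ClkNonneg κ2) (h : RegEquiv c κ1 κ2)
    (Δ1 : ℝ) (hΔ1 : 0 ≤ Δ1) :
    ∃ Δ2 : ℝ, 0 ≤ Δ2 ∧ RegEquiv c (shiftVal κ1 Δ1) (shiftVal κ2 Δ2) := by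
  obtain ⟨hact, hfloor, hfract, hzero⟩ := h
  obtain ⟨t, ht0, ht1, hst, hlt, heq⟩ :=
    exists_matching_threshold (ι := {x // κ1 x ≤ (c x : ℝ)})
      (fun x => Int.fract (κ1 x)) (fun x => Int.fract (κ2 x))
      (fun _ => Int.fract_nonneg _) (fun _ => Int.fract_lt_one _) (fun _ => Int.fract_lt_one _)
      (fun x y => hfract x y x.2 y.2) (fun x => hzero x x.2)
      (s := 1 - Int.fract Δ1) (by linarith [Int.fract_lt_one Δ1])
      (by linarith [Int.fract_nonneg Δ1])
  have hs0 : 0 < 1 - Int.fract Δ1 := by linarith [Int.fract_lt_one Δ1]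
  have hs1 : 1 - Int.fract Δ1 ≤ 1 := by linarith [Int.fract_nonneg Δ1]
  have hΔ : Δ1 = ⌊Δ1⌋ + (1 - (1 - Int.fract Δ1)) := by linarith [Int.floor_add_fract Δ1]
  have hn : (0 : ℝ) ≤ ⌊Δ1⌋ := by exact_mod_cast Int.floor_nonneg.2 hΔ1
  generalize 1 - Int.fract Δ1 = s at *
  generalize ⌊Δ1⌋ = n at *
  subst hΔ
  have hΔ2 : (0 : ℝ) ≤ n + (1 - t) := by linarith
  have hfloor' : ∀ x, κ1 x ≤ c x → ⌊κ1 x + (n + (1 - s))⌋ = ⌊κ2 x + (n + (1 - t))⌋ := by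
    intro x hx
    have hx' := hlt ⟨x, hx⟩
    rcases lt_or_ge (Int.fract (κ1 x)) s with h | h
    · rw [(floor_fract_add_of_fract_lt n hs1 h).1,
        (floor_fract_add_of_fract_lt n ht1 (hx'.1 h)).1, hfloor x hx]
    · rw [(floor_fract_add_of_le_fract n hs0 h).1,
        (floor_fract_add_of_le_fract n ht0 (not_lt.1 (mt hx'.2 h.not_gt))).1, hfloor x hx]
  have hzero' : ∀ x, κ1 x ≤ c x →
      (Int.fract (κ1 x + (n + (1 - s))) = 0 ↔ Int.fract (κ2 x + (n + (1 - t))) = 0) := by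
    intro x hx
    have hx' := hlt ⟨x, hx⟩
    rcases lt_or_ge (Int.fract (κ1 x)) s with h | h
    · rw [(floor_fract_add_of_fract_lt n hs1 h).2,
        (floor_fract_add_of_fract_lt n ht1 (hx'.1 h)).2,
        add_eq_zero_iff_of_nonneg (Int.fract_nonneg _) (by linarith),
        add_eq_zero_iff_of_nonneg (Int.fract_nonneg _) (by linarith), hzero x hx,
        sub_eq_zero, sub_eq_zero, eq_comm (b := s), hst, eq_comm (b := t)]
    · rw [(floor_fract_add_of_le_fract n hs0 h).2,
        (floor_fract_add_of_le_fract n ht0 (not_lt.1 (mt hx'.2 h.not_gt))).2,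
        sub_eq_zero, sub_eq_zero]
      exact heq ⟨x, hx⟩
  have hactive : ∀ x, κ1 x + (n + (1 - s)) ≤ c x → κ1 x ≤ c x := fun x hx => by linarith
  refine ⟨n + (1 - t), hΔ2, fun x => ?_, fun x hx => hfloor' x (hactive x hx),
    fun x y hx hy => ?_, fun x hx => hzero' x (hactive x hx)⟩
  · by_cases hx : κ1 x ≤ c x
    · simp only [shiftVal, le_natCast_iff_floor_fract, hfloor' x hx, hzero' x hx]
    · refine iff_of_false (fun h => hx (hactive x h)) fun h => hx ((hact x).2 ?_)
      simp only [shiftVal] at h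
      linarith
  · have hx := hactive x hx
    have hy := hactive y hy
    have hx' := hlt ⟨x, hx⟩
    have hy' := hlt ⟨y, hy⟩
    have hxy := hfract x y hx hy
    simp only [shiftVal]
    rcases lt_or_ge (Int.fract (κ1 x)) s with h | h <;>
      rcases lt_or_ge (Int.fract (κ1 y)) s with h' | h'
    · rw [(floor_fract_add_of_fract_lt n hs1 h).2, (floor_fract_add_of_fract_lt n hs1 h').2,
        (floor_fract_add_of_fract_lt n ht1 (hx'.1 h)).2,
        (floor_fract_add_of_fract_lt n ht1 (hy'.1 h')).2, add_le_add_iff_right,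
        add_le_add_iff_right, hxy]
    · rw [(floor_fract_add_of_fract_lt n hs1 h).2, (floor_fract_add_of_le_fract n hs0 h').2,
        (floor_fract_add_of_fract_lt n ht1 (hx'.1 h)).2,
        (floor_fract_add_of_le_fract n ht0 (not_lt.1 (mt hy'.2 h'.not_gt))).2]
      refine iff_of_false ?_ ?_ <;> rw [not_le]
      · linarith [Int.fract_nonneg (κ1 x), Int.fract_lt_one (κ1 y)]
      · linarith [Int.fract_nonneg (κ2 x), Int.fract_lt_one (κ2 y)]
    · rw [(floor_fract_add_of_le_fract n hs0 h).2, (floor_fract_add_of_fract_lt n hs1 h').2,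
        (floor_fract_add_of_le_fract n ht0 (not_lt.1 (mt hx'.2 h.not_gt))).2,
        (floor_fract_add_of_fract_lt n ht1 (hy'.1 h')).2]
      refine iff_of_true ?_ ?_
      · linarith [Int.fract_nonneg (κ1 y), Int.fract_lt_one (κ1 x)]
      · linarith [Int.fract_nonneg (κ2 y), Int.fract_lt_one (κ2 x)]
    · rw [(floor_fract_add_of_le_fract n hs0 h).2, (floor_fract_add_of_le_fract n hs0 h').2,
        (floor_fract_add_of_le_fract n ht0 (not_lt.1 (mt hx'.2 h.not_gt))).2,
        (floor_fract_add_of_le_fract n ht0 (not_lt.1 (mt hy'.2 h'.not_gt))).2,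
        sub_le_sub_iff_right, sub_le_sub_iff_right, hxy]

end TPG
end

section
/- If kappa1 and kappa2 are clock valuations with kappa1 ≅ kappa2, then for every subset lambda ⊆ C we have kappa1[lambda:=0] ≅ kappa2[lambda:=0], where kappa[lambda:=0] denotes the valuation that is 0 on the clocks in lambda and agrees with kappa on all other clocks. -/
namespace TPG

/-- clock resets preserve region equivalence (time-abstract
bisimulation, clock-reset part). -/
theorem regEquiv_reset {C : Type} [Fintype C] (c : C → ℕ) (κ1 κ2 : C → ℝ)
    (h1 : ClkNonneg κ1) (h2 : ClkNonneg κ2) (h : RegEquiv c κ1 κ2)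
    (lam : Set C) :
    RegEquiv c (resetClk κ1 lam) (resetClk κ2 lam) := by
  obtain ⟨hle, hfloor, hfract, hzero⟩ := h
  have fract_le_zero_iff (t : ℝ) : Int.fract t ≤ 0 ↔ Int.fract t = 0 :=
    (Int.fract_nonneg t).ge_iff_eq'
  refine ⟨fun x => ?_, fun x hx => ?_, fun x y hx hy => ?_, fun x hx => ?_⟩
  · by_cases hxl : x ∈ lam
    · simp [resetClk, hxl]
    · simpa [resetClk, hxl] using hle x
  · by_cases hxl : x ∈ lam
    · simp [resetClk, hxl]
    · simp only [resetClk, hxl, if_false] at hx ⊢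
      exact hfloor x hx
  · by_cases hxl : x ∈ lam
    · simp [resetClk, hxl]
    · by_cases hyl : y ∈ lam
      · simp only [resetClk, hxl, hyl, if_false, if_true, Int.fract_zero,
          fract_le_zero_iff] at hx ⊢
        exact hzero x hx
      · simp only [resetClk, hxl, hyl, if_false] at hx hy ⊢
        exact hfract x y hx hy
  · by_cases hxl : x ∈ lam
    · simp [resetClk, hxl]
    · simp only [resetClk, hxl, if_false] at hx ⊢
      exact hzero x hx

end TPG
end

section
/- Let Y, Y1', Y2' be clock regions, and suppose some kappa0 ∈ Y and reals delta1, delta2 ≥ 0 satisfy kappa0 + delta1 ∈ Y1' and kappa0 + delta2 ∈ Y2'. Then exactly one of the following holds: (1) Y1' ≠ Y2' and for every kappa ∈ Y and all Delta1, Delta2 ≥ 0 with kappa + Delta1 ∈ Y1' and kappa + Delta2 ∈ Y2', we have Delta1 < Delta2; (2) Y1' ≠ Y2' and for every kappa ∈ Y and all Delta1, Delta2 ≥ 0 with kappa + Delta1 ∈ Y1' and kappa + Delta2 ∈ Y2', we have Delta2 < Delta1; (3) Y1' = Y2', in which case for every kappa ∈ Y and every Delta1 ≥ 0 with kappa + Delta1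 ∈ Y1' there exists Delta2 ≥ 0 with kappa + Delta2 ∈ Y2' and Delta2 = Delta1. In particular, whether a time delay reaching Y1' is shorter than a time delay reaching Y2' depends only on the regions Y, Y1', Y2' and not on the particular valuation in Y or the particular delays. -/
namespace TPG

theorem RegEquiv.symm {C : Type} {c : C → ℕ} {κ1 κ2 : C → ℝ} (h : RegEquiv c κ1 κ2) :
    RegEquiv c κ2 κ1 := by
  obtain ⟨hle, hfloor, hfract, hzero⟩ := h
  refine ⟨fun x => (hle x).symm, fun x hx => (hfloor x ((hle x).2 hx)).symm, fun x y hx hy => ?_,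
    fun x hx => (hzero x ((hle x).2 hx)).symm⟩
  exact (hfract x y ((hle x).2 hx) ((hle y).2 hy)).symm

theorem RegEquiv.trans {C : Type} {c : C → ℕ} {κ1 κ2 κ3 : C → ℝ} (h : RegEquiv c κ1 κ2)
    (h' : RegEquiv c κ2 κ3) : RegEquiv c κ1 κ3 := by
  obtain ⟨hle, hfloor, hfract, hzero⟩ := h
  obtain ⟨hle', hfloor', hfract', hzero'⟩ := h'
  refine ⟨fun x => (hle x).trans (hle' x),
    fun x hx => (hfloor x hx).trans (hfloor' x ((hle x).1 hx)), fun x y hx hy => ?_,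
    fun x hx => (hzero x hx).trans (hzero' x ((hle x).1 hx))⟩
  exact (hfract x y hx hy).trans (hfract' x y ((hle x).1 hx) ((hle y).1 hy))

theorem IsRegion.regEquiv {C : Type} {c : C → ℕ} {Y : Set (C → ℝ)} (hY : IsRegion c Y)
    {κ1 κ2 : C → ℝ} (h1 : κ1 ∈ Y) (h2 : κ2 ∈ Y) : RegEquiv c κ1 κ2 := by
  obtain ⟨κ, -, rfl⟩ := hY
  exact h1.2.symm.trans h2.2

theorem IsRegion.eq_regOf {C : Type} {c : C → ℕ} {Y : Set (C → ℝ)} (hY : IsRegion c Y)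
    {κ : C → ℝ} (h : κ ∈ Y) : Y = regOf c κ := by
  obtain ⟨κ', -, rfl⟩ := hY
  ext κ''
  exact ⟨fun h' => ⟨h'.1, h.2.symm.trans h'.2⟩, fun h' => ⟨h'.1, h.2.trans h'.2⟩⟩

theorem IsRegion.eq_of_regEquiv {C : Type} {c : C → ℕ} {Y1 Y2 : Set (C → ℝ)}
    (hY1 : IsRegion c Y1) (hY2 : IsRegion c Y2) {κ1 κ2 : C → ℝ} (h1 : κ1 ∈ Y1) (h2 : κ2 ∈ Y2)
    (h : RegEquiv c κ1 κ2) : Y1 = Y2 := by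
  rw [hY1.eq_regOf h1, hY2.eq_regOf h2]
  ext κ
  exact ⟨fun h' => ⟨h'.1, h.symm.trans h'.2⟩, fun h' => ⟨h'.1, h.trans h'.2⟩⟩

/-- If the regions of two delayed valuations are visited in opposite orders from `κ` and from `κ'`,
then they coincide. -/
theorem regEquiv_shiftVal_of_lt_of_lt {C : Type} {c : C → ℕ} {κ κ' : C → ℝ} {δ1 δ2 Δ1 Δ2 : ℝ}
    (h1 : RegEquiv c (shiftVal κ δ1) (shiftVal κ' Δ1))
    (h2 : RegEquiv c (shiftVal κ δ2) (shiftVal κ' Δ2)) (hδ : δ1 < δ2) (hΔ : Δ2 < Δ1) :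
    RegEquiv c (shiftVal κ δ1) (shiftVal κ δ2) := by
  obtain ⟨hle1, hfloor1, -, hzero1⟩ := h1
  obtain ⟨hle2, hfloor2, -, -⟩ := h2
  simp only [RegEquiv, shiftVal] at *
  have hle : ∀ x, κ x + δ1 ≤ c x ↔ κ x + δ2 ≤ c x := fun x =>
    ⟨fun hx => (hle2 x).2 (by linarith [(hle1 x).1 hx]), fun hx => by linarith⟩
  have hfloor' : ∀ x, κ x + δ1 ≤ c x → ⌊κ' x + Δ2⌋ = ⌊κ' x + Δ1⌋ ∧
      ⌊κ x + δ1⌋ = ⌊κ x + δ2⌋ := by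
    intro x hx
    have e1 := hfloor1 x hx
    have e2 := hfloor2 x ((hle x).1 hx)
    have l1 : ⌊κ x + δ1⌋ ≤ ⌊κ x + δ2⌋ := Int.floor_mono (by linarith)
    have l2 : ⌊κ' x + Δ2⌋ ≤ ⌊κ' x + Δ1⌋ := Int.floor_mono (by linarith)
    omega
  have hfloor := fun x hx => (hfloor' x hx).2
  refine ⟨hle, hfloor, fun x y hx hy => ?_, fun x hx => ?_⟩
  · simp only [Int.fract, hfloor x hx, hfloor y hy]
    constructor <;> intro h <;> linarith
  · constructor
    · intro h
      have h' := (hzero1 x hx).1 h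
      have hnn := Int.fract_nonneg (κ' x + Δ2)
      simp only [Int.fract, (hfloor' x hx).1] at h' hnn
      linarith
    · intro h
      have hnn := Int.fract_nonneg (κ x + δ1)
      simp only [Int.fract, hfloor x hx] at h hnn ⊢
      linarith

theorem delay_lt_of_delay_lt {C : Type} {c : C → ℕ} {Y1 Y2 : Set (C → ℝ)}
    (hY1 : IsRegion c Y1) (hY2 : IsRegion c Y2) (hne : Y1 ≠ Y2) {κ κ' : C → ℝ} {δ1 δ2 Δ1 Δ2 : ℝ}
    (h1 : shiftVal κ δ1 ∈ Y1) (h2 : shiftVal κ δ2 ∈ Y2) (hδ : δ1 < δ2)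
    (h1' : shiftVal κ' Δ1 ∈ Y1) (h2' : shiftVal κ' Δ2 ∈ Y2) : Δ1 < Δ2 := by
  by_contra! hΔ
  refine hne ?_
  rcases hΔ.eq_or_lt with rfl | hΔ
  · exact (hY1.eq_regOf h1').trans (hY2.eq_regOf h2').symm
  · exact hY1.eq_of_regEquiv hY2 h1 h2 (regEquiv_shiftVal_of_lt_of_lt
      (hY1.regEquiv h1 h1') (hY2.regEquiv h2 h2') hδ hΔ)

/-- delays from a region into two fixed target regions are
uniformly ordered: exactly one of the three cases holds, independently of the
particular valuation in `Y` and the particular delays. -/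
theorem regions_uniform_delay_order {C : Type} [Fintype C] (c : C → ℕ)
    (Y Y1 Y2 : Set (C → ℝ))
    (hY : IsRegion c Y) (hY1 : IsRegion c Y1) (hY2 : IsRegion c Y2)
    (κ0 : C → ℝ) (hκ0 : κ0 ∈ Y)
    (δ1 δ2 : ℝ) (hδ1 : 0 ≤ δ1) (hδ2 : 0 ≤ δ2)
    (h1 : shiftVal κ0 δ1 ∈ Y1) (h2 : shiftVal κ0 δ2 ∈ Y2) :
    (((Y1 ≠ Y2 ∧ ∀ κ ∈ Y, ∀ Δ1 Δ2 : ℝ, 0 ≤ Δ1 → 0 ≤ Δ2 →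
          shiftVal κ Δ1 ∈ Y1 → shiftVal κ Δ2 ∈ Y2 → Δ1 < Δ2) ∧
        ¬ (Y1 ≠ Y2 ∧ ∀ κ ∈ Y, ∀ Δ1 Δ2 : ℝ, 0 ≤ Δ1 → 0 ≤ Δ2 →
          shiftVal κ Δ1 ∈ Y1 → shiftVal κ Δ2 ∈ Y2 → Δ2 < Δ1) ∧
        ¬ (Y1 = Y2)) ∨
      ((¬ (Y1 ≠ Y2 ∧ ∀ κ ∈ Y, ∀ Δ1 Δ2 : ℝ, 0 ≤ Δ1 → 0 ≤ Δ2 →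
          shiftVal κ Δ1 ∈ Y1 → shiftVal κ Δ2 ∈ Y2 → Δ1 < Δ2)) ∧
        (Y1 ≠ Y2 ∧ ∀ κ ∈ Y, ∀ Δ1 Δ2 : ℝ, 0 ≤ Δ1 → 0 ≤ Δ2 →
          shiftVal κ Δ1 ∈ Y1 → shiftVal κ Δ2 ∈ Y2 → Δ2 < Δ1) ∧
        ¬ (Y1 = Y2)) ∨
      ((¬ (Y1 ≠ Y2 ∧ ∀ κ ∈ Y, ∀ Δ1 Δ2 : ℝ, 0 ≤ Δ1 → 0 ≤ Δ2 →
          shiftVal κ Δ1 ∈ Y1 → shiftVal κ Δ2 ∈ Y2 → Δ1 < Δ2)) ∧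
        (¬ (Y1 ≠ Y2 ∧ ∀ κ ∈ Y, ∀ Δ1 Δ2 : ℝ, 0 ≤ Δ1 → 0 ≤ Δ2 →
          shiftVal κ Δ1 ∈ Y1 → shiftVal κ Δ2 ∈ Y2 → Δ2 < Δ1)) ∧
        (Y1 = Y2 ∧ ∀ κ ∈ Y, ∀ Δ1 : ℝ, 0 ≤ Δ1 → shiftVal κ Δ1 ∈ Y1 →
          ∃ Δ2 : ℝ, 0 ≤ Δ2 ∧ shiftVal κ Δ2 ∈ Y2 ∧ Δ2 = Δ1))) := by
  by_cases hne : Y1 = Y2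
  · subst hne
    exact Or.inr (Or.inr ⟨fun h => h.1 rfl, fun h => h.1 rfl, rfl,
      fun κ _ Δ1 hΔ1 h => ⟨Δ1, hΔ1, h, rfl⟩⟩)
  · rcases lt_trichotomy δ1 δ2 with hδ | rfl | hδ
    · refine Or.inl ⟨⟨hne, fun κ _ Δ1 Δ2 _ _ h1' h2' => ?_⟩, fun h => ?_, hne⟩
      · exact delay_lt_of_delay_lt hY1 hY2 hne h1 h2 hδ h1' h2'
      · exact (h.2 κ0 hκ0 δ1 δ2 hδ1 hδ2 h1 h2).not_gt hδ
    · exact absurd ((hY1.eq_regOf h1).trans (hY2.eq_regOf h2).symm) hne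
    · refine Or.inr (Or.inl ⟨fun h => ?_, ⟨hne, fun κ _ Δ1 Δ2 _ _ h1' h2' => ?_⟩, hne⟩)
      · exact (h.2 κ0 hκ0 δ1 δ2 hδ1 hδ2 h1 h2).not_gt hδ
      · exact delay_lt_of_delay_lt hY2 hY1 (Ne.symm hne) h2 h1 hδ h2' h1'

end TPG
end

section
/- The region equivalence relation ≅ on clock valuations has only finitely many equivalence classes; more precisely, the number of clock regions is at most (∏_{x∈C} (c(x)+1)) · |C|! · 2^{2|C|}. Consequently, if L is a finite set of locations and states (l1,kappa1), (l2,kappa2) are declared region-equivalent iff l1 = l2 and kappa1 ≅ kappa2, then the number of state regions is at most |L| · (∏_{x∈C} (c(x)+1)) · |C|! · 2^{2|C|}. -/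
namespace TPG

/-- A state region: a location together with a clock region. -/
def stRegOf {L C : Type} (c : C → ℕ) (l : L) (κ : C → ℝ) : Set (L × (C → ℝ)) :=
  {p | p.1 = l ∧ ClkNonneg p.2 ∧ RegEquiv c κ p.2}

/-- `Y` is a state region. -/
def IsStateRegion {L C : Type} (c : C → ℕ) (Y : Set (L × (C → ℝ))) : Prop :=
  ∃ l κ, ClkNonneg κ ∧ Y = stRegOf c l κ

/-- The positions at which a sequence attains a positive value larger than all earlier ones. -/
def jumpSet {n : ℕ} (f : Fin n → ℝ) : Set (Fin n) :=
  {k | 0 < f k ∧ ∀ j < k, f j < f k}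

theorem exists_mem_jumpSet {n : ℕ} {f : Fin n → ℝ} {t : ℝ} (ht : 0 ≤ t) (i : Fin n)
    (hi : t < f i) : ∃ k ∈ jumpSet f, k ≤ i ∧ t < f k := by
  induction i using WellFoundedLT.induction with
  | ind i ih =>
    by_cases h : ∃ j < i, t < f j
    · obtain ⟨j, hji, hj⟩ := h
      obtain ⟨k, hk, hkj, htk⟩ := ih j hji hj
      exact ⟨k, hk, hkj.trans hji.le, htk⟩
    · push Not at h
      exact ⟨i, ⟨ht.trans_lt hi, fun j hj => (h j hj).trans_lt hi⟩, le_rfl, hi⟩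

theorem le_iff_forall_mem_jumpSet {n : ℕ} {f : Fin n → ℝ} (hf : Monotone f)
    (h0 : ∀ i, 0 ≤ f i) (i j : Fin n) : f i ≤ f j ↔ ∀ k ∈ jumpSet f, k ≤ i → k ≤ j := by
  constructor
  · intro hij k hk hki
    by_contra! hjk
    exact absurd (hk.2 j hjk) (not_lt.2 ((hf hki).trans hij))
  · intro h
    by_contra! hij
    obtain ⟨k, hk, hki, hjk⟩ := exists_mem_jumpSet (h0 j) i hij
    exact absurd (hf (h k hk hki)) (not_le.2 hjk)

theorem eq_zero_iff_forall_mem_jumpSet {n : ℕ} {f : Fin n → ℝ} (hf : Monotone f)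
    (h0 : ∀ i, 0 ≤ f i) (i : Fin n) : f i = 0 ↔ ∀ k ∈ jumpSet f, ¬ k ≤ i := by
  constructor
  · intro hi k hk hki
    exact absurd (hk.1.trans_le (hf hki)) (by simp [hi])
  · intro h
    by_contra hi
    obtain ⟨k, hk, hki, -⟩ := exists_mem_jumpSet le_rfl i ((h0 i).lt_of_ne' hi)
    exact h k hk hki

open Classical in
/-- The fractional part of a clock that has not exceeded its ceiling, and `0` otherwise. -/
noncomputable def boundedFract {C : Type} (c : C → ℕ) (κ : C → ℝ) (x : C) : ℝ :=
  if κ x ≤ (c x : ℝ) then Int.fract (κ x) else 0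

theorem boundedFract_nonneg {C : Type} (c : C → ℕ) (κ : C → ℝ) (x : C) :
    0 ≤ boundedFract c κ x := by
  unfold boundedFract
  split_ifs <;> simp

/-- The fractional parts of the clocks, listed in a fixed order of the clocks. -/
noncomputable def fractSeq {C : Type} [Fintype C] (c : C → ℕ) (κ : C → ℝ) :
    Fin (Fintype.card C) → ℝ :=
  boundedFract c κ ∘ (Fintype.equivFin C).symm

/-- Finite data determining a clock region: truncated integer parts, an ordering of the clocks by
fractional part, the clocks below their ceilings, and the jumps in the ordered fractional parts. -/
abbrev RegionCode {C : Type} [Fintype C] (c : C → ℕ) : Type :=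
  ((x : C) → Fin (c x + 1)) × Equiv.Perm (Fin (Fintype.card C)) ×
    Set C × Set (Fin (Fintype.card C))

/-- The code of the region of a valuation. -/
noncomputable def regionCode {C : Type} [Fintype C] (c : C → ℕ) (κ : C → ℝ) : RegionCode c :=
  (fun x => ⟨min ⌊κ x⌋₊ (c x), by omega⟩, Tuple.sort (fractSeq c κ),
    {x | κ x ≤ (c x : ℝ)}, jumpSet (fractSeq c κ ∘ Tuple.sort (fractSeq c κ)))

theorem card_regionCode {C : Type} [Fintype C] (c : C → ℕ) :
    Nat.card (RegionCode c) = (∏ x : C, (c x + 1)) * (Fintype.card C).factorial *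
      2 ^ (2 * Fintype.card C) := by
  classical
  simp only [Nat.card_eq_fintype_card, Fintype.card_prod, Fintype.card_pi, Fintype.card_fin,
    Fintype.card_perm, Fintype.card_set]
  ring

section

variable {C : Type} [Fintype C] {c : C → ℕ} {κ κ1 κ2 : C → ℝ}

theorem boundedFract_eq_sort (x : C) : boundedFract c κ x =
    (fractSeq c κ ∘ Tuple.sort (fractSeq c κ))
      ((Tuple.sort (fractSeq c κ)).symm (Fintype.equivFin C x)) := by
  simp [fractSeq]

theorem boundedFract_le_iff (x y : C) : boundedFract c κ x ≤ boundedFract c κ y ↔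
    ∀ k ∈ (regionCode c κ).2.2.2,
      k ≤ (regionCode c κ).2.1.symm (Fintype.equivFin C x) →
        k ≤ (regionCode c κ).2.1.symm (Fintype.equivFin C y) := by
  rw [boundedFract_eq_sort x, boundedFract_eq_sort y]
  exact le_iff_forall_mem_jumpSet (Tuple.monotone_sort (fractSeq c κ))
    (fun _ => boundedFract_nonneg _ _ _) _ _

theorem boundedFract_eq_zero_iff (x : C) : boundedFract c κ x = 0 ↔
    ∀ k ∈ (regionCode c κ).2.2.2,
      ¬ k ≤ (regionCode c κ).2.1.symm (Fintype.equivFin C x) := by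
  rw [boundedFract_eq_sort x]
  exact eq_zero_iff_forall_mem_jumpSet (Tuple.monotone_sort (fractSeq c κ))
    (fun _ => boundedFract_nonneg _ _ _) _

theorem regEquiv_of_regionCode_eq (h1 : ClkNonneg κ1) (h2 : ClkNonneg κ2)
    (h : regionCode c κ1 = regionCode c κ2) : RegEquiv c κ1 κ2 := by
  have hb (x : C) : κ1 x ≤ (c x : ℝ) ↔ κ2 x ≤ (c x : ℝ) :=
    Set.ext_iff.1 (congrArg (fun r => r.2.2.1) h) x
  have hf {κ : C → ℝ} {x : C} (hx : κ x ≤ (c x : ℝ)) :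
      Int.fract (κ x) = boundedFract c κ x := (if_pos hx).symm
  refine ⟨hb, fun x hx => ?_, fun x y hx hy => ?_, fun x hx => ?_⟩
  · have hfl : min ⌊κ1 x⌋₊ (c x) = min ⌊κ2 x⌋₊ (c x) :=
      congrArg Fin.val (congrFun (congrArg Prod.fst h) x)
    rw [min_eq_left (Nat.floor_le_of_le hx), min_eq_left (Nat.floor_le_of_le ((hb x).1 hx))] at hfl
    rw [← Int.natCast_floor_eq_floor (h1 x), ← Int.natCast_floor_eq_floor (h2 x), hfl]
  · rw [hf hx, hf hy, hf ((hb x).1 hx), hf ((hb y).1 hy), boundedFract_le_iff,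
      boundedFract_le_iff, h]
  · rw [hf hx, hf ((hb x).1 hx), boundedFract_eq_zero_iff, boundedFract_eq_zero_iff, h]

end

theorem RegEquiv.congr_left {C : Type} {c : C → ℕ} {κ1 κ2 : C → ℝ} (h : RegEquiv c κ1 κ2)
    (κ : C → ℝ) : RegEquiv c κ1 κ ↔ RegEquiv c κ2 κ :=
  ⟨h.symm.trans, h.trans⟩

theorem exists_injective_regions {C : Type} [Fintype C] (c : C → ℕ) :
    ∃ f : {Y : Set (C → ℝ) // IsRegion c Y} → RegionCode c, Function.Injective f := by
  choose κ hκ hY using fun Y : {Y : Set (C → ℝ) // IsRegion c Y} => Y.2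
  refine ⟨fun Y => regionCode c (κ Y), fun Y Y' h => Subtype.ext ?_⟩
  rw [hY Y, hY Y']
  ext κ'
  simp only [regOf, Set.mem_ofPred_eq,
    (regEquiv_of_regionCode_eq (hκ Y) (hκ Y') h).congr_left κ']

theorem exists_injective_stateRegions {C L : Type} [Fintype C] (c : C → ℕ) :
    ∃ f : {Y : Set (L × (C → ℝ)) // IsStateRegion c Y} → L × RegionCode c,
      Function.Injective f := by
  choose l κ hκ hY using fun Y : {Y : Set (L × (C → ℝ)) // IsStateRegion c Y} => Y.2
  refine ⟨fun Y => (l Y, regionCode c (κ Y)), fun Y Y' h => Subtype.ext ?_⟩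
  rw [Prod.mk.injEq] at h
  rw [hY Y, hY Y', h.1]
  ext p
  simp only [stRegOf, Set.mem_ofPred_eq,
    (regEquiv_of_regionCode_eq (hκ Y) (hκ Y') h.2).congr_left p.2]

/-- there are only finitely many clock regions, at most
`(∏ x, (c x + 1)) · |C|! · 2^(2|C|)` many; and at most
`|L| · (∏ x, (c x + 1)) · |C|! · 2^(2|C|)` state regions. -/
theorem finitely_many_regions {C L : Type} [Fintype C] [Fintype L] (c : C → ℕ) :
    (({Y : Set (C → ℝ) | IsRegion c Y}.Finite ∧
        Nat.card {Y : Set (C → ℝ) // IsRegion c Y} ≤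
          (∏ x : C, (c x + 1)) * (Fintype.card C).factorial *
            2 ^ (2 * Fintype.card C))) ∧
    (({Y : Set (L × (C → ℝ)) | IsStateRegion c Y}.Finite ∧
        Nat.card {Y : Set (L × (C → ℝ)) // IsStateRegion c Y} ≤
          Fintype.card L * ((∏ x : C, (c x + 1)) * (Fintype.card C).factorial *
            2 ^ (2 * Fintype.card C)))) := by
  obtain ⟨f, hf⟩ := exists_injective_regions c
  obtain ⟨g, hg⟩ := exists_injective_stateRegions (L := L) c
  refine ⟨⟨Finite.of_injective f hf, ?_⟩, ⟨Finite.of_injective g hg, ?_⟩⟩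
  · rw [← card_regionCode]
    exact Nat.card_le_card_of_injective f hf
  · rw [← card_regionCode, ← Nat.card_eq_fintype_card, ← Nat.card_prod]
    exact Nat.card_le_card_of_injective g hg

end TPG
end
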